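/- For each natural number n, define the Hermite function φₙ : ℝ → ℝ by φₙ(x) = (2ⁿ · n! · √π)^{−1/2} · Hₙ(x) · e^{−x²/2}, where Hₙ is the n-th physicists' Hermite polynomial. Then φₙ is an eigenfunction of the harmonic oscillator with eigenvalue 2n + 1: for all x ∈ ℝ, −φₙ″(x) + x²·φₙ(x) = (2n+1)·φₙ(x). -/

import Mathlib

/-- The physicists' Hermite polynomials: `H₀ = 1`, `H₁ = 2x`,
`H_{n+2} = 2x·H_{n+1} − 2(n+1)·Hₙ`. -/
noncomputable def physHermite : ℕ → Polynomial ℝ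
  | 0 => 1
  | 1 => Polynomial.C 2 * Polynomial.X
  | n + 2 => Polynomial.C 2 * Polynomial.X * physHermite (n + 1)
      - Polynomial.C (2 * ((n : ℝ) + 1)) * physHermite n

/-- The normalized Hermite function `φₙ(x) = (2ⁿ n! √π)^{−1/2} Hₙ(x) e^{−x²/2}`. -/
noncomputable def hermiteFun (n : ℕ) (x : ℝ) : ℝ :=
  ((2 : ℝ) ^ n * (n.factorial : ℝ) * Real.sqrt Real.pi) ^ (-(1 : ℝ) / 2)
    * (physHermite n).eval x * Real.exp (-x ^ 2 / 2)

theorem physHermite_succ_and_derivative_succ (n : ℕ) :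
    physHermite (n + 1) = Polynomial.C 2 * Polynomial.X * physHermite n
        - Polynomial.derivative (physHermite n) ∧
      Polynomial.derivative (physHermite (n + 1))
        = Polynomial.C (2 * ((n : ℝ) + 1)) * physHermite n := by
  induction n with
  | zero => simp [physHermite]
  | succ k ih =>
    obtain ⟨h_raise, h_deriv⟩ := ih
    have h_rec : physHermite (k + 1 + 1) = Polynomial.C 2 * Polynomial.X * physHermite (k + 1)
        - Polynomial.C (2 * ((k : ℝ) + 1)) * physHermite k := by rw [physHermite]
    refine ⟨by rw [h_rec, h_deriv], ?_⟩
    rw [h_rec]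
    simp only [Polynomial.derivative_sub, Polynomial.derivative_mul, Polynomial.derivative_C,
      Polynomial.derivative_X, h_deriv]
    rw [h_raise]
    push_cast
    simp only [Polynomial.C_mul, Polynomial.C_add, Polynomial.C_1]
    ring

/-- The Hermite differential equation `Hₙ″ − 2x·Hₙ′ + 2n·Hₙ = 0`. -/
theorem derivative_derivative_physHermite (n : ℕ) :
    Polynomial.derivative (Polynomial.derivative (physHermite n))
      = Polynomial.C 2 * Polynomial.X * Polynomial.derivative (physHermite n)
        - Polynomial.C (2 * (n : ℝ)) * physHermite n := by
  obtain ⟨h_raise, h_deriv⟩ := physHermite_succ_and_derivative_succ n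
  rw [h_raise] at h_deriv
  simp only [Polynomial.derivative_sub, Polynomial.derivative_mul, Polynomial.derivative_C,
    Polynomial.derivative_X, Polynomial.C_mul, Polynomial.C_add, Polynomial.C_1] at h_deriv ⊢
  linear_combination -h_deriv

theorem hasDerivAt_const_mul_eval_mul_exp_neg_sq_div_two (c : ℝ) (p : Polynomial ℝ) (x : ℝ) :
    HasDerivAt (fun y : ℝ => c * p.eval y * Real.exp (-y ^ 2 / 2))
      (c * (Polynomial.derivative p - Polynomial.X * p).eval x * Real.exp (-x ^ 2 / 2)) x := by
  have h_exp : HasDerivAt (fun y : ℝ => Real.exp (-y ^ 2 / 2))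
      (Real.exp (-x ^ 2 / 2) * (-(2 * x) / 2)) x := by
    simpa using (((hasDerivAt_pow 2 x).neg).div_const 2).exp
  refine (((p.hasDerivAt x).const_mul c).mul h_exp).congr_deriv ?_
  simp only [Polynomial.eval_sub, Polynomial.eval_mul, Polynomial.eval_X]
  ring

/-- The Hermite function `φₙ` is an eigenfunction of the harmonic oscillator
`−d²/dx² + x²` with eigenvalue `2n + 1`. -/
theorem hermiteFun_eigenfunction (n : ℕ) :
    ∀ x : ℝ, -(deriv (deriv (hermiteFun n)) x) + x ^ 2 * hermiteFun n x
      = (2 * (n : ℝ) + 1) * hermiteFun n x := by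
  intro x
  have h_first : deriv (hermiteFun n) = fun y : ℝ =>
      ((2 : ℝ) ^ n * (n.factorial : ℝ) * Real.sqrt Real.pi) ^ (-(1 : ℝ) / 2)
        * (Polynomial.derivative (physHermite n) - Polynomial.X * physHermite n).eval y
        * Real.exp (-y ^ 2 / 2) :=
    funext fun y => (hasDerivAt_const_mul_eval_mul_exp_neg_sq_div_two _ _ y).deriv
  rw [h_first, (hasDerivAt_const_mul_eval_mul_exp_neg_sq_div_two _ _ x).deriv]
  simp only [hermiteFun, Polynomial.derivative_sub, Polynomial.derivative_mul,
    Polynomial.derivative_X, derivative_derivative_physHermite, Polynomial.eval_sub,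
    Polynomial.eval_mul, Polynomial.eval_add, Polynomial.eval_X, Polynomial.eval_C,
    Polynomial.eval_one]
  ring
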